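/- arXiv:1706.08701 — 5 statements merged into one kernel-verified Lean document; each statement's English description precedes it below -/
import Mathlib

section
/- Let 0 ≤ p ≤ 1, let A be a real m×n matrix with m < n, and let y be in the range of A. Then the set of minimizers of ‖z‖_p subject to the constraint Az = y contains a point with at most m non-zero entries. -/
/-- The entrywise `ℓ^p` (quasi-)norm on `ℝ^n` for `0 ≤ p ≤ 1`:
for `p = 0` it counts the non-zero entries, and for `p > 0` it is
`(∑ i, |z i| ^ p) ^ (1/p)`. -/
noncomputable def lpQNorm {n : ℕ} (p : ℝ) (z : Fin n → ℝ) : ℝ :=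
  if p = 0 then (Finset.univ.filter fun i => z i ≠ 0).card
  else (∑ i, |z i| ^ p) ^ (1 / p)

/-- `z` has minimal support with respect to `A`: no non-zero kernel vector of `A` is supported in
the support of `z`. -/
def HasIndependentSupport {m n : ℕ} (A : Matrix (Fin m) (Fin n) ℝ) (z : Fin n → ℝ) : Prop :=
  ∀ v : Fin n → ℝ, A.mulVec v = 0 → (∀ i, z i = 0 → v i = 0) → v = 0

lemma lpQNorm_le_of_rpow_sum_le {n : ℕ} {p : ℝ} (hp : 0 ≤ p) {z w : Fin n → ℝ}
    (hsupp : ∀ i, z i = 0 → w i = 0) (hsum : ∑ i, |w i| ^ p ≤ ∑ i, |z i| ^ p) :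
    lpQNorm p w ≤ lpQNorm p z := by
  unfold lpQNorm
  split_ifs with h
  · exact_mod_cast Finset.card_le_card
      (Finset.monotone_filter_right _ fun i _ => mt (hsupp i))
  · exact Real.rpow_le_rpow (Finset.sum_nonneg fun i _ => Real.rpow_nonneg (abs_nonneg _) _)
      hsum (by positivity)

/-- A sum of powers decreases along a direction in which its linearization does, as long as no
coordinate changes sign. -/
lemma sum_abs_mul_one_add_rpow_le {n : ℕ} {p : ℝ} (hp0 : 0 ≤ p) (hp1 : p ≤ 1)
    {z r : Fin n → ℝ} {t : ℝ} (ht : 0 ≤ t) (hr : ∀ i, 0 ≤ 1 + t * r i)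
    (hsum : ∑ i, |z i| ^ p * r i ≤ 0) :
    ∑ i, |z i * (1 + t * r i)| ^ p ≤ ∑ i, |z i| ^ p := by
  calc ∑ i, |z i * (1 + t * r i)| ^ p
      ≤ ∑ i, (|z i| ^ p + p * t * (|z i| ^ p * r i)) := by
        refine Finset.sum_le_sum fun i _ => ?_
        rw [abs_mul, abs_of_nonneg (hr i), Real.mul_rpow (abs_nonneg _) (hr i)]
        have h := rpow_one_add_le_one_add_mul_self (s := t * r i) (by linarith [hr i]) hp0 hp1
        have := mul_le_mul_of_nonneg_left h (Real.rpow_nonneg (abs_nonneg (z i)) p)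
        linarith
    _ = ∑ i, |z i| ^ p + p * t * ∑ i, |z i| ^ p * r i := by
        rw [Finset.sum_add_distrib, Finset.mul_sum]
    _ ≤ ∑ i, |z i| ^ p := by
        linarith [mul_nonpos_of_nonneg_of_nonpos (mul_nonneg hp0 ht) hsum]

lemma exists_support_ssubset_lpQNorm_le {m n : ℕ} {p : ℝ} (hp0 : 0 ≤ p) (hp1 : p ≤ 1)
    {A : Matrix (Fin m) (Fin n) ℝ} {z : Fin n → ℝ} (hz : ¬ HasIndependentSupport A z) :
    ∃ w : Fin n → ℝ, A.mulVec w = A.mulVec z ∧ lpQNorm p w ≤ lpQNorm p z ∧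
      (Finset.univ.filter fun i => w i ≠ 0) ⊂ Finset.univ.filter fun i => z i ≠ 0 := by
  obtain ⟨v, hAv, hv, hv0, hsum⟩ : ∃ v : Fin n → ℝ, A.mulVec v = 0 ∧
      (∀ i, z i = 0 → v i = 0) ∧ v ≠ 0 ∧ ∑ i, |z i| ^ p * (v i / z i) ≤ 0 := by
    unfold HasIndependentSupport at hz
    push Not at hz
    obtain ⟨v, hAv, hv, hv0⟩ := hz
    rcases le_total (∑ i, |z i| ^ p * (v i / z i)) 0 with h | h
    · exact ⟨v, hAv, hv, hv0, h⟩
    · refine ⟨-v, by simp [Matrix.mulVec_neg, hAv], fun i hi => by simp [hv i hi],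
        neg_ne_zero.mpr hv0, ?_⟩
      simpa [neg_div] using h
  obtain ⟨j, hj⟩ : ∃ j, v j / z j < 0 := by
    by_contra! hnonneg
    have hterm : ∀ i ∈ Finset.univ, 0 ≤ |z i| ^ p * (v i / z i) := fun i _ =>
      mul_nonneg (Real.rpow_nonneg (abs_nonneg _) _) (hnonneg i)
    have hzero := (Finset.sum_eq_zero_iff_of_nonneg hterm).mp
      (le_antisymm hsum (Finset.sum_nonneg hterm))
    refine hv0 (funext fun i => ?_)
    by_cases hi : z i = 0
    · exact hv i hi
    · have hpos : |z i| ^ p ≠ 0 := (Real.rpow_pos_of_pos (abs_pos.mpr hi) p).ne'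
      simpa [hpos, hi] using hzero i (Finset.mem_univ i)
  obtain ⟨k, -, hk⟩ := Finset.exists_min_image Finset.univ (fun i => v i / z i)
    ⟨j, Finset.mem_univ j⟩
  set r : Fin n → ℝ := fun i => v i / z i with hr
  have hrk : r k < 0 := (hk j (Finset.mem_univ j)).trans_lt hj
  have hzk : z k ≠ 0 := fun h => by simp [hr, h] at hrk
  set t : ℝ := -(r k)⁻¹ with ht
  have ht0 : 0 < t := neg_pos.mpr (inv_lt_zero.mpr hrk)
  have htk : 1 + t * r k = 0 := by rw [ht]; field_simp [hrk.ne]; ring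
  have hone : ∀ i, 0 ≤ 1 + t * r i := fun i => by
    have := mul_le_mul_of_nonneg_left (hk i (Finset.mem_univ i)) ht0.le
    linarith
  have hw : (fun i => z i * (1 + t * r i)) = z + t • v := by
    funext i
    by_cases hi : z i = 0
    · simp [hi, hv i hi]
    · simp only [hr, Pi.add_apply, Pi.smul_apply, smul_eq_mul]
      field_simp
  refine ⟨fun i => z i * (1 + t * r i), ?_, ?_, ?_⟩
  · rw [hw, Matrix.mulVec_add, Matrix.mulVec_smul, hAv, smul_zero, add_zero]
  · exact lpQNorm_le_of_rpow_sum_le hp0 (fun i hi => by simp [hi])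
      (sum_abs_mul_one_add_rpow_le hp0 hp1 ht0.le hone hsum)
  · refine (Finset.ssubset_iff_of_subset ?_).mpr ⟨k, by simpa using hzk, by simp [htk]⟩
    exact Finset.monotone_filter_right _ fun i _ hi => left_ne_zero_of_mul hi

lemma exists_hasIndependentSupport_lpQNorm_le {m n : ℕ} {p : ℝ} (hp0 : 0 ≤ p) (hp1 : p ≤ 1)
    (A : Matrix (Fin m) (Fin n) ℝ) (z : Fin n → ℝ) :
    ∃ w : Fin n → ℝ, A.mulVec w = A.mulVec z ∧ lpQNorm p w ≤ lpQNorm p z ∧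
      HasIndependentSupport A w := by
  induction hs : (Finset.univ.filter fun i => z i ≠ 0) using Finset.strongInduction
    generalizing z with
  | H s ih =>
    by_cases hz : HasIndependentSupport A z
    · exact ⟨z, rfl, le_rfl, hz⟩
    · obtain ⟨w, hAw, hle, hlt⟩ := exists_support_ssubset_lpQNorm_le hp0 hp1 hz
      obtain ⟨u, hAu, hule, hu⟩ := ih _ (hs ▸ hlt) w rfl
      exact ⟨u, hAu.trans hAw, hule.trans hle, hu⟩

lemma finite_setOf_hasIndependentSupport {m n : ℕ} (A : Matrix (Fin m) (Fin n) ℝ)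
    (y : Fin m → ℝ) : {z | A.mulVec z = y ∧ HasIndependentSupport A z}.Finite := by
  refine Set.Finite.of_injOn (f := fun z : Fin n → ℝ => {i | z i ≠ 0}) (t := Set.univ)
    (fun _ _ => Set.mem_univ _) ?_ Set.finite_univ
  rintro z ⟨hAz, hz⟩ w ⟨hAw, -⟩ hzw
  refine sub_eq_zero.mp (hz (z - w) (by rw [Matrix.mulVec_sub, hAz, hAw, sub_self]) ?_)
  intro i hi
  have hiff : z i ≠ 0 ↔ w i ≠ 0 := Set.ext_iff.mp hzw i
  have hwi : w i = 0 := by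
    by_contra h
    exact hiff.mpr h hi
  simp [hi, hwi]

lemma HasIndependentSupport.card_le {m n : ℕ} {A : Matrix (Fin m) (Fin n) ℝ} {z : Fin n → ℝ}
    (hz : HasIndependentSupport A z) : (Finset.univ.filter fun i => z i ≠ 0).card ≤ m := by
  let E : ({i // z i ≠ 0} → ℝ) →ₗ[ℝ] (Fin n → ℝ) :=
    Function.ExtendByZero.linearMap ℝ Subtype.val
  have hE : ∀ x i, E x i.val = x i := fun x i => Subtype.val_injective.extend_apply x 0 i
  have hinj : Function.Injective (A.mulVecLin ∘ₗ E) := by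
    refine (injective_iff_map_eq_zero _).mpr fun (x : {i // z i ≠ 0} → ℝ) hx => ?_
    have hEx : E x = 0 := hz (E x) hx fun i hi => by
      have hnot : ¬ ∃ a : {i // z i ≠ 0}, a.val = i := fun ⟨a, ha⟩ => a.2 (ha ▸ hi)
      exact Function.extend_apply' x (0 : Fin n → ℝ) i hnot
    funext i
    rw [← hE x i, hEx]
    rfl
  simpa [Fintype.card_subtype] using LinearMap.finrank_le_finrank_of_injective hinj

/-- For `0 ≤ p ≤ 1`, an `m × n` real matrix `A` with `m < n`, and
`y` in the range of `A`, the set of minimizers of `‖z‖_p` subject to `A z = y`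
contains a point with at most `m` non-zero entries. -/
theorem sparse_point_in_lp_minimizers {m n : ℕ} (p : ℝ) (hp0 : 0 ≤ p) (hp1 : p ≤ 1)
    (hmn : m < n) (A : Matrix (Fin m) (Fin n) ℝ) (y : Fin m → ℝ)
    (hy : ∃ z : Fin n → ℝ, A.mulVec z = y) :
    ∃ z : Fin n → ℝ,
      (A.mulVec z = y ∧ ∀ z' : Fin n → ℝ, A.mulVec z' = y → lpQNorm p z ≤ lpQNorm p z') ∧
      (Finset.univ.filter fun i => z i ≠ 0).card ≤ m := by
  obtain ⟨z₀, hz₀⟩ := hy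
  obtain ⟨w₀, hAw₀, -, hw₀⟩ := exists_hasIndependentSupport_lpQNorm_le hp0 hp1 A z₀
  obtain ⟨z, ⟨hAz, hz⟩, hmin⟩ := Set.exists_min_image _ (lpQNorm p)
    (finite_setOf_hasIndependentSupport A y) ⟨w₀, hAw₀.trans hz₀, hw₀⟩
  refine ⟨z, ⟨hAz, fun z' hz' => ?_⟩, hz.card_le⟩
  obtain ⟨w, hAw, hle, hw⟩ := exists_hasIndependentSupport_lpQNorm_le hp0 hp1 A z'
  exact (hmin w ⟨hAw.trans hz', hw⟩).trans hle
end

section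
/- Let A ∈ R^{m×n} have columns in general position, let y ∈ R^m be in the range of A, and assume A is in general position with respect to y. Then the basis pursuit problem min{‖x‖_1 : Ax = y} has a unique solution. -/
/-- `A` has columns in general position: for any `k < m`, the affine span of any
`k+1` signed columns `±a_{i₁}, …, ±a_{i_{k+1}}` does not contain any signed column
`±a_i` with `i ∉ {i₁, …, i_{k+1}}`. -/
def ColsInGeneralPosition {m n : ℕ} (A : Matrix (Fin m) (Fin n) ℝ) : Prop :=
  ∀ k : ℕ, k < m → ∀ s : Finset (Fin n), s.card = k + 1 →
    ∀ σ : Fin n → ℝ, (∀ j, σ j = 1 ∨ σ j = -1) →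
      ∀ i ∉ s, ∀ ε : ℝ, (ε = 1 ∨ ε = -1) →
        (ε • fun r => A r i) ∉ affineSpan ℝ ((fun j => σ j • fun r => A r j) '' ↑s)

/-- `A` is in general position with respect to `y`: for any `k < m`, `y` does not
belong to the linear span of any `k` columns of `A`. -/
def InGeneralPositionWrt {m n : ℕ} (A : Matrix (Fin m) (Fin n) ℝ) (y : Fin m → ℝ) : Prop :=
  ∀ k : ℕ, k < m → ∀ s : Finset (Fin n), s.card = k →
    y ∉ Submodule.span ℝ ((fun j => fun r => A r j) '' ↑s)

/-- If `x` has minimal `ℓ¹` norm among the solutions of `A x' = A x` and `z ∈ ker A` is supported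
in the support of `x`, then moving along `z` does not change the `ℓ¹` norm to first order. -/
theorem sum_sign_mul_eq_zero_of_minimal {m n : ℕ} {A : Matrix (Fin m) (Fin n) ℝ}
    {x z : Fin n → ℝ}
    (hx : ∀ x' : Fin n → ℝ, A.mulVec x' = A.mulVec x → ∑ j, |x j| ≤ ∑ j, |x' j|)
    (hz : A.mulVec z = 0) (hxz : ∀ j, x j = 0 → z j = 0) :
    ∑ j, (SignType.sign (x j) : ℝ) * z j = 0 := by
  have hmin : IsLocalMin (fun t : ℝ => ∑ j, |x j + t * z j|) 0 := by
    refine Filter.Eventually.of_forall fun t => ?_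
    have h := hx (x + t • z) (by rw [Matrix.mulVec_add, Matrix.mulVec_smul, hz]; simp)
    simpa using h
  refine hmin.hasDerivAt_eq_zero (HasDerivAt.fun_sum fun j _ => ?_)
  by_cases hj : x j = 0
  · simpa [hj, hxz j hj] using hasDerivAt_const (0 : ℝ) (0 : ℝ)
  · have hlin : HasDerivAt (fun t : ℝ => x j + t * z j) (z j) 0 := by
      simpa using ((hasDerivAt_id (0 : ℝ)).mul_const (z j)).const_add (x j)
    have habs : HasDerivAt (fun u : ℝ => |u|) (SignType.sign (x j) : ℝ) (x j + 0 * z j) := by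
      simpa using hasDerivAt_abs hj
    exact habs.comp (0 : ℝ) hlin

/-- A point with nonzero weight in an affine dependence lies in the affine span of the other
points. -/
theorem mem_affineSpan_image_of_sum_eq_zero {ι V : Type*} [AddCommGroup V] [Module ℝ V]
    {s : Finset ι} {i : ι} {w : ι → ℝ} {p : ι → V} (hwi : w i ≠ 0)
    (hw : w i + ∑ j ∈ s, w j = 0) (hp : w i • p i + ∑ j ∈ s, w j • p j = 0) :
    p i ∈ affineSpan ℝ (p '' (s : Set ι)) := by
  have hsum : ∑ j ∈ s, -(w i)⁻¹ * w j = 1 := by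
    rw [← Finset.mul_sum, eq_neg_of_add_eq_zero_right hw]
    field_simp
  have hcomb : s.affineCombination ℝ p (fun j => -(w i)⁻¹ * w j) = p i := by
    rw [s.affineCombination_eq_linear_combination _ _ hsum]
    simp_rw [mul_smul]
    rw [← Finset.smul_sum, eq_neg_of_add_eq_zero_right hp, smul_neg, neg_smul, neg_neg,
      smul_smul, inv_mul_cancel₀ hwi, one_smul]
  rw [← hcomb]
  exact affineCombination_mem_affineSpan_image hsum (fun _ hj hj' => absurd hj hj') p

/-- If no nonzero kernel vector supported in the support of `z` vanishes at `i`, then the support of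
`z` without `i` has at most `m` elements, as the corresponding columns are linearly independent. -/
theorem card_support_erase_le_of_minimal {m n : ℕ} {A : Matrix (Fin m) (Fin n) ℝ}
    {z : Fin n → ℝ} {i : Fin n}
    (hmin : ∀ z' : Fin n → ℝ, A.mulVec z' = 0 → (∀ j, z j = 0 → z' j = 0) → z' i = 0 → z' = 0) :
    ((Finset.univ.filter fun j => z j ≠ 0).erase i).card ≤ m := by
  classical
  set s := (Finset.univ.filter fun j => z j ≠ 0).erase i with hs
  have hli : LinearIndependent ℝ (fun j : s => A.col j) := by
    rw [Fintype.linearIndependent_iff]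
    intro g hg j
    set z' : Fin n → ℝ := fun j => if h : j ∈ s then g ⟨j, h⟩ else 0 with hz'
    have hker : A.mulVec z' = 0 := by
      rw [← hg]
      ext r
      simp only [Matrix.mulVec, dotProduct, Finset.sum_apply, Pi.smul_apply, Matrix.col_apply,
        smul_eq_mul]
      rw [← Finset.sum_subset (Finset.subset_univ s)
        (fun j _ hj => by simp [hz', hj]), ← Finset.sum_coe_sort s]
      exact Finset.sum_congr rfl fun j _ => by simp [hz', mul_comm]
    have h0 := hmin z' hker (fun j hj => by simp [hz', hs, hj]) (by simp [hz', hs])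
    simpa [hz'] using congrFun h0 j
  simpa using hli.fintype_card_le_finrank

/-- The columns of `A` on the support of an `ℓ¹`-minimal solution are linearly independent. -/
theorem ker_eq_zero_of_support_subset_minimal {m n : ℕ} {A : Matrix (Fin m) (Fin n) ℝ}
    (hcols : ColsInGeneralPosition A) {x : Fin n → ℝ}
    (hx : ∀ x' : Fin n → ℝ, A.mulVec x' = A.mulVec x → ∑ j, |x j| ≤ ∑ j, |x' j|)
    {z : Fin n → ℝ} (hz : A.mulVec z = 0) (hxz : ∀ j, x j = 0 → z j = 0) : z = 0 := by
  classical
  induction hN : (Finset.univ.filter fun j => z j ≠ 0).card using Nat.strong_induction_on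
    generalizing z with
  | _ N ih =>
  by_contra hne
  obtain ⟨i, hi⟩ : ∃ i, z i ≠ 0 := Function.ne_iff.mp hne
  have hcard := card_support_erase_le_of_minimal (A := A) (i := i) fun z' hz' hsub hi' => by
    refine ih _ ?_ hz' (fun j hj => hsub j (hxz j hj)) rfl
    rw [← hN]
    refine Finset.card_lt_card (Finset.ssubset_iff_of_subset ?_ |>.mpr ⟨i, ?_, ?_⟩)
    · intro j
      simpa using mt (hsub j)
    · simpa using hi
    · simpa using hi'
  set S := Finset.univ.filter fun j => z j ≠ 0 with hS
  have hiS : i ∈ S := by simpa [hS] using hi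
  set σ : Fin n → ℝ := fun j => if x j < 0 then -1 else 1 with hσ
  have hσ1 : ∀ j, σ j = 1 ∨ σ j = -1 := fun j => by
    by_cases h : x j < 0 <;> simp [hσ, h]
  have hσz : ∀ j, (SignType.sign (x j) : ℝ) * z j = σ j * z j := fun j => by
    rcases lt_trichotomy (x j) 0 with h | h | h
    · simp [hσ, h]
    · simp [hxz j h]
    · simp [hσ, h, h.not_gt]
  have hσsq : ∀ j, σ j * σ j = 1 := fun j => by
    rcases hσ1 j with h | h <;> simp [h]
  have hsplit : ∀ {V : Type} [AddCommGroup V] (f : Fin n → V), (∀ j, z j = 0 → f j = 0) →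
      f i + ∑ j ∈ S.erase i, f j = ∑ j, f j := fun f hf => by
    rw [Finset.add_sum_erase S f hiS]
    exact Finset.sum_subset (Finset.subset_univ S) fun j _ hj => hf j (by simpa [hS] using hj)
  have hw : σ i * z i + ∑ j ∈ S.erase i, σ j * z j = 0 := by
    rw [hsplit (fun j => σ j * z j) (fun j hj => by simp [hj]),
      ← sum_sign_mul_eq_zero_of_minimal hx hz hxz]
    exact Finset.sum_congr rfl fun j _ => (hσz j).symm
  have hp : (σ i * z i) • (σ i • fun r => A r i)
      + ∑ j ∈ S.erase i, (σ j * z j) • (σ j • fun r => A r j) = 0 := by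
    rw [hsplit (fun j => (σ j * z j) • (σ j • fun r => A r j)) (fun j hj => by simp [hj]), ← hz]
    ext r
    simp only [Finset.sum_apply, Pi.smul_apply, smul_eq_mul, Matrix.mulVec, dotProduct]
    exact Finset.sum_congr rfl fun j _ => by linear_combination A r j * z j * hσsq j
  have hwi : σ i * z i ≠ 0 := mul_ne_zero (fun h => by simpa [h] using hσsq i) hi
  have hpos : 0 < (S.erase i).card := by
    rw [Finset.card_pos, Finset.nonempty_iff_ne_empty]
    intro h
    exact hwi (by simpa [h] using hw)
  exact hcols ((S.erase i).card - 1) (by omega) (S.erase i) (by omega) σ hσ1 i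
    (Finset.notMem_erase i S) (σ i) (hσ1 i)
    (mem_affineSpan_image_of_sum_eq_zero (w := fun j => σ j * z j)
      (p := fun j => σ j • fun r => A r j) hwi hw hp)

/-- A solvable linear system has a solution of minimal `ℓ¹` norm. -/
theorem exists_minimal_sum_abs {m n : ℕ} (A : Matrix (Fin m) (Fin n) ℝ) {y : Fin m → ℝ}
    (hy : ∃ x : Fin n → ℝ, A.mulVec x = y) :
    ∃ x : Fin n → ℝ,
      A.mulVec x = y ∧ ∀ x' : Fin n → ℝ, A.mulVec x' = y → ∑ j, |x j| ≤ ∑ j, |x' j| := by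
  obtain ⟨x₀, hx₀⟩ := hy
  have hnorm : ∀ x : Fin n → ℝ, ‖x‖ ≤ ∑ j, |x j| := fun x =>
    (pi_norm_le_iff_of_nonneg (Finset.sum_nonneg fun j _ => abs_nonneg _)).mpr fun j =>
      Finset.single_le_sum (f := fun j => |x j|) (fun j _ => abs_nonneg _) (Finset.mem_univ j)
  have hclosed : IsClosed {x : Fin n → ℝ | A.mulVec x = y} :=
    isClosed_eq (continuous_const.matrix_mulVec continuous_id) continuous_const
  obtain ⟨x, ⟨-, hxy⟩, hmin⟩ :=
    ((isCompact_closedBall (0 : Fin n → ℝ) (∑ j, |x₀ j|)).inter_right hclosed).exists_isMinOn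
      (f := fun x : Fin n → ℝ => ∑ j, |x j|) ⟨x₀, by simpa using hnorm x₀, hx₀⟩
      (by fun_prop)
  refine ⟨x, hxy, fun x' hx' => ?_⟩
  by_cases h : ∑ j, |x' j| ≤ ∑ j, |x₀ j|
  · exact hmin ⟨by simpa using (hnorm x').trans h, hx'⟩
  · exact (hmin ⟨by simpa using hnorm x₀, hx₀⟩ : ∑ j, |x j| ≤ ∑ j, |x₀ j|).trans (not_le.mp h).le

/-- If `A` has columns in general position, `y` is in the range of `A`,
and `A` is in general position with respect to `y`, then the basis pursuit problem
`min {‖x‖₁ : A x = y}` has a unique solution. -/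
theorem basis_pursuit_unique_solution {m n : ℕ}
    (A : Matrix (Fin m) (Fin n) ℝ) (y : Fin m → ℝ)
    (hcols : ColsInGeneralPosition A)
    (hy : ∃ x : Fin n → ℝ, A.mulVec x = y)
    (hgen : InGeneralPositionWrt A y) :
    ∃! x : Fin n → ℝ,
      A.mulVec x = y ∧ ∀ x' : Fin n → ℝ, A.mulVec x' = y → ∑ j, |x j| ≤ ∑ j, |x' j| := by
  obtain ⟨x, hxy, hx⟩ := exists_minimal_sum_abs A hy
  refine ⟨x, ⟨hxy, hx⟩, fun x' ⟨hxy', hx'⟩ => ?_⟩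
  have hmid : A.mulVec ((1 / 2 : ℝ) • (x + x')) = y := by
    rw [Matrix.mulVec_smul, Matrix.mulVec_add, hxy, hxy', ← two_smul ℝ y, smul_smul]
    norm_num
  have heq : ∑ j, |x j| = ∑ j, |x' j| := le_antisymm (hx x' hxy') (hx' x hxy)
  have hle : ∀ j ∈ Finset.univ, |((1 / 2 : ℝ) • (x + x')) j| ≤ (|x j| + |x' j|) / 2 := fun j _ => by
    simp only [Pi.smul_apply, Pi.add_apply, smul_eq_mul, abs_mul]
    rw [abs_of_pos (by norm_num : (0 : ℝ) < 1 / 2)]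
    linarith [abs_add_le (x j) (x' j)]
  have havg : ∑ j, (|x j| + |x' j|) / 2 = ∑ j, |x j| := by
    rw [← Finset.sum_div, Finset.sum_add_distrib, ← heq]
    ring
  have hterm := (Finset.sum_eq_sum_iff_of_le hle).mp
    (le_antisymm (Finset.sum_le_sum hle) (havg.trans_le (hx _ hmid)))
  refine sub_eq_zero.mp (ker_eq_zero_of_support_subset_minimal hcols
    (x := (1 / 2 : ℝ) • (x + x')) (fun v hv => ?_) ?_ fun j hj => ?_)
  · exact (Finset.sum_le_sum hle).trans (havg.trans_le (hx v (hv.trans hmid)))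
  · rw [Matrix.mulVec_sub, hxy, hxy', sub_self]
  · have h := hterm j (Finset.mem_univ j)
    rw [hj, abs_zero] at h
    have h1 : x j = 0 := abs_eq_zero.mp (by linarith [abs_nonneg (x j), abs_nonneg (x' j)])
    have h2 : x' j = 0 := abs_eq_zero.mp (by linarith [abs_nonneg (x j), abs_nonneg (x' j)])
    simp [h1, h2]
end

section
/- Let A ∈ R^{m×n} with m < n and 0 ≤ p ≤ 1. Then the set ginv_p(A) of generalized inverses of A minimizing the entrywise ℓ^p norm contains a matrix X with at most m non-zero entries in each column, and hence at most m² non-zero entries in total. -/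
/-- The entrywise `ℓ^p` (quasi-)norm of a matrix `X ∈ ℝ^{n×m}` for `0 ≤ p ≤ 1`:
for `p = 0` it counts the non-zero entries of `X`, and for `p > 0` it is
`(∑ ij, |x_{ij}| ^ p) ^ (1/p)`. -/
noncomputable def matLpQNorm {n m : ℕ} (p : ℝ) (X : Matrix (Fin n) (Fin m) ℝ) : ℝ :=
  if p = 0 then
    ((Finset.univ : Finset (Fin n × Fin m)).filter fun ij => X ij.1 ij.2 ≠ 0).card
  else (∑ i, ∑ j, |X i j| ^ p) ^ (1 / p)

/-- `X` is a generalized inverse of `A`, i.e. `A X A = A`. -/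
def IsGenInverse {m n : ℕ} (A : Matrix (Fin m) (Fin n) ℝ) (X : Matrix (Fin n) (Fin m) ℝ) :
    Prop :=
  A * X * A = A

open Finset in
/-- A finite family with a positive member can be rescaled so that its maximum is `1`. -/
lemma exists_pos_scaling_le_one {ι : Type*} [Fintype ι] (r : ι → ℝ) (hr : ∃ i, 0 < r i) :
    ∃ s : ℝ, 0 < s ∧ (∀ i, s * r i ≤ 1) ∧ ∃ i, s * r i = 1 := by
  obtain ⟨i₀, hi₀⟩ := hr
  obtain ⟨k, -, hk⟩ := exists_max_image univ r ⟨i₀, mem_univ i₀⟩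
  have hpos : 0 < r k := hi₀.trans_le (hk i₀ (mem_univ i₀))
  refine ⟨(r k)⁻¹, inv_pos.mpr hpos, fun i => ?_, k, inv_mul_cancel₀ hpos.ne'⟩
  rw [inv_mul_le_iff₀ hpos, mul_one]
  exact hk i (mem_univ i)

/-- If a nonzero kernel vector is supported inside the support of `x`, then `x` can be moved along
it so that the support shrinks without increasing a separable monotone concave cost. -/
lemma exists_support_ssubset_cost_le {ι V : Type*} [Fintype ι] [AddCommGroup V] [Module ℝ V]
    (L : (ι → ℝ) →ₗ[ℝ] V) {ψ : ℝ → ℝ} (hψ : ConcaveOn ℝ (Set.Ici 0) ψ)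
    (hmono : MonotoneOn ψ (Set.Ici 0)) (x z : ι → ℝ) (hLz : L z = 0)
    (hzx : z.support ⊆ x.support) (hz : z ≠ 0) :
    ∃ y, L y = L x ∧ ∑ i, ψ |y i| ≤ ∑ i, ψ |x i| ∧ y.support ⊂ x.support := by
  wlog hpos : ∃ i, 0 < z i / x i generalizing z
  · refine this (-z) (by simp [hLz]) (by simpa using hzx) (by simpa using hz) ?_
    obtain ⟨i, hi⟩ := Function.ne_iff.mp hz
    have hxi : x i ≠ 0 := hzx hi
    push Not at hpos
    refine ⟨i, ?_⟩
    rw [Pi.neg_apply, neg_div]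
    exact neg_pos.mpr (lt_of_le_of_ne (hpos i) (div_ne_zero hi hxi))
  set r : ι → ℝ := fun i => z i / x i with hr
  have hrx (i : ι) : x i * r i = z i := by
    by_cases h : x i = 0
    · have : z i = 0 := by
        by_contra hzi
        exact hzx hzi h
      simp [h, this]
    · simp only [hr]
      field_simp
  have move (s : ℝ) (hs : ∃ i, s * r i = 1) :
      L (fun i => x i * (1 - s * r i)) = L x ∧
        (fun i => x i * (1 - s * r i)).support ⊂ x.support := by
    constructor
    · have : (fun i => x i * (1 - s * r i)) = x - s • z := by
        ext i
        simp only [Pi.sub_apply, Pi.smul_apply, smul_eq_mul, ← hrx i]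
        ring
      rw [this, map_sub, map_smul, hLz, smul_zero, sub_zero]
    · obtain ⟨i, hi⟩ := hs
      refine (Set.ssubset_iff_of_subset fun k hk => left_ne_zero_of_mul hk).mpr ⟨i, ?_, ?_⟩
      · intro h
        simp [hr, h] at hi
      · exact fun h => h (by simp [hi])
  have abs_move (s : ℝ) (hs : ∀ i, s * r i ≤ 1) (i : ι) :
      |x i * (1 - s * r i)| = |x i| * (1 - s * r i) := by
    rw [abs_mul, abs_of_nonneg (sub_nonneg.mpr (hs i))]
  obtain ⟨a, ha, ha1, ha2⟩ := exists_pos_scaling_le_one r hpos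
  by_cases hneg : ∃ i, 0 < -r i
  · obtain ⟨b, hb, hb1, hb2⟩ := exists_pos_scaling_le_one (fun i => -r i) hneg
    have hb1' (i : ι) : -b * r i ≤ 1 := by linarith [hb1 i]
    have hb2' : ∃ i, -b * r i = 1 := by
      obtain ⟨i, hi⟩ := hb2
      exact ⟨i, by linarith⟩
    have key : b / (a + b) * ∑ i, ψ |x i * (1 - a * r i)| +
        a / (a + b) * ∑ i, ψ |x i * (1 - -b * r i)| ≤ ∑ i, ψ |x i| := by
      rw [Finset.mul_sum, Finset.mul_sum, ← Finset.sum_add_distrib]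
      refine Finset.sum_le_sum fun i _ => ?_
      have := hψ.2 (Set.mem_Ici.mpr (abs_nonneg (x i * (1 - a * r i))))
        (Set.mem_Ici.mpr (abs_nonneg (x i * (1 - -b * r i))))
        (show 0 ≤ b / (a + b) by positivity) (show 0 ≤ a / (a + b) by positivity)
        (by field_simp; ring)
      have hx : (b / (a + b)) • |x i * (1 - a * r i)| + (a / (a + b)) • |x i * (1 - -b * r i)|
          = |x i| := by
        rw [abs_move a ha1, abs_move (-b) hb1', smul_eq_mul, smul_eq_mul]
        field_simp
        ring
      rwa [hx] at this
    by_cases hc : ∑ i, ψ |x i * (1 - a * r i)| ≤ ∑ i, ψ |x i|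
    · exact ⟨_, (move a ha2).1, hc, (move a ha2).2⟩
    · refine ⟨_, (move (-b) hb2').1, ?_, (move (-b) hb2').2⟩
      by_contra hc'
      have h1 := mul_lt_mul_of_pos_left (not_le.mp hc) (show 0 < b / (a + b) by positivity)
      have h2 := mul_lt_mul_of_pos_left (not_le.mp hc') (show 0 < a / (a + b) by positivity)
      have h3 : b / (a + b) * ∑ i, ψ |x i| + a / (a + b) * ∑ i, ψ |x i| = ∑ i, ψ |x i| := by
        field_simp
        ring
      linarith
  · push Not at hneg
    refine ⟨_, (move a ha2).1, Finset.sum_le_sum fun i _ => ?_, (move a ha2).2⟩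
    refine hmono (Set.mem_Ici.mpr (abs_nonneg _)) (Set.mem_Ici.mpr (abs_nonneg _)) ?_
    rw [abs_move a ha1]
    have : 0 ≤ a * r i := mul_nonneg ha.le (by linarith [hneg i])
    nlinarith [abs_nonneg (x i)]

/-- `x` is a basic vector for `L` if `L` is injective on vectors supported in the support of `x`. -/
def IsBasicVector {ι V : Type*} [AddCommGroup V] [Module ℝ V]
    (L : (ι → ℝ) →ₗ[ℝ] V) (x : ι → ℝ) : Prop :=
  ∀ z, L z = 0 → z.support ⊆ x.support → z = 0

lemma exists_isBasicVector_cost_le {ι V : Type*} [Fintype ι] [AddCommGroup V] [Module ℝ V]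
    (L : (ι → ℝ) →ₗ[ℝ] V) {ψ : ℝ → ℝ} (hψ : ConcaveOn ℝ (Set.Ici 0) ψ)
    (hmono : MonotoneOn ψ (Set.Ici 0)) (x : ι → ℝ) :
    ∃ y, L y = L x ∧ ∑ i, ψ |y i| ≤ ∑ i, ψ |x i| ∧ IsBasicVector L y := by
  induction h : x.support.ncard using Nat.strong_induction_on generalizing x with
  | _ k ih =>
    by_cases hx : IsBasicVector L x
    · exact ⟨x, rfl, le_rfl, hx⟩
    · simp only [IsBasicVector] at hx
      push Not at hx
      obtain ⟨z, hLz, hzx, hz⟩ := hx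
      obtain ⟨y, hLy, hcy, hsy⟩ := exists_support_ssubset_cost_le L hψ hmono x z hLz hzx hz
      obtain ⟨w, hLw, hcw, hw⟩ := ih _ (h ▸ Set.ncard_lt_ncard hsy (Set.toFinite _)) y rfl
      exact ⟨w, hLw.trans hLy, hcw.trans hcy, hw⟩

lemma finite_setOf_isBasicVector {ι V : Type*} [Finite ι] [AddCommGroup V] [Module ℝ V]
    (L : (ι → ℝ) →ₗ[ℝ] V) (b : V) : {x | L x = b ∧ IsBasicVector L x}.Finite := by
  refine Set.Finite.of_finite_image (f := Function.support) (Set.toFinite _) ?_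
  rintro x ⟨hx, hxb⟩ y ⟨hy, -⟩ (hxy : x.support = y.support)
  refine sub_eq_zero.mp (hxb (x - y) (by rw [map_sub, hx, hy, sub_self]) ?_)
  exact (Function.support_sub x y).trans (by rw [← hxy, Set.union_self])

/-- A separable monotone concave cost attains its minimum on every nonempty affine fibre of `L`. -/
lemma exists_cost_minimizer {ι V : Type*} [Fintype ι] [AddCommGroup V] [Module ℝ V]
    (L : (ι → ℝ) →ₗ[ℝ] V) {ψ : ℝ → ℝ} (hψ : ConcaveOn ℝ (Set.Ici 0) ψ)
    (hmono : MonotoneOn ψ (Set.Ici 0)) (x₀ : ι → ℝ) :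
    ∃ x, L x = L x₀ ∧ ∀ y, L y = L x₀ → ∑ i, ψ |x i| ≤ ∑ i, ψ |y i| := by
  obtain ⟨w, hLw, -, hw⟩ := exists_isBasicVector_cost_le L hψ hmono x₀
  obtain ⟨x, ⟨hLx, -⟩, hx⟩ := Set.exists_min_image _ (fun x : ι → ℝ => ∑ i, ψ |x i|)
    (finite_setOf_isBasicVector L (L x₀)) ⟨w, hLw, hw⟩
  refine ⟨x, hLx, fun y hy => ?_⟩
  obtain ⟨v, hLv, hcv, hv⟩ := exists_isBasicVector_cost_le L hψ hmono y
  exact (hx v ⟨hLv.trans hy, hv⟩).trans hcv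

open Finset in
lemma IsBasicVector.card_support_le_finrank {ι V : Type*} [Fintype ι] [AddCommGroup V]
    [Module ℝ V] [Module.Finite ℝ V] {L : (ι → ℝ) →ₗ[ℝ] V} {x : ι → ℝ}
    (hx : IsBasicVector L x) : #{i | x i ≠ 0} ≤ Module.finrank ℝ V := by
  classical
  let E := Function.ExtendByZero.linearMap ℝ (Subtype.val : {i // x i ≠ 0} → ι)
  have hinj : Function.Injective (L ∘ₗ E) := by
    rw [← LinearMap.ker_eq_bot, LinearMap.ker_eq_bot']
    intro z hz
    have hE : E z = 0 := by
      refine hx _ hz fun i hi => ?_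
      by_contra hxi
      refine hi (Function.extend_apply' _ _ _ ?_)
      rintro ⟨k, rfl⟩
      exact k.2 (by simpa using hxi)
    ext i
    have := congrFun hE i
    simpa [E, Subtype.val_injective.extend_apply] using this
  have := LinearMap.finrank_le_finrank_of_injective hinj
  rwa [Module.finrank_fintype_fun_eq_card, Fintype.card_subtype] at this

lemma exists_isGenInverse {m n : ℕ} (A : Matrix (Fin m) (Fin n) ℝ) : ∃ X, IsGenInverse A X := by
  let f := Matrix.toLin' A
  obtain ⟨g, hg⟩ := f.rangeRestrict.exists_rightInverse_of_surjective f.range_rangeRestrict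
  obtain ⟨h, hh⟩ := g.exists_extend
  refine ⟨LinearMap.toMatrix' h, Matrix.toLin'.injective (LinearMap.ext fun v => ?_)⟩
  have h1 : h (f v) = g (f.rangeRestrict v) := LinearMap.congr_fun hh (f.rangeRestrict v)
  have h2 : f (g (f.rangeRestrict v)) = f v :=
    congrArg Subtype.val (LinearMap.congr_fun hg (f.rangeRestrict v))
  rw [Matrix.toLin'_mul, Matrix.toLin'_mul, Matrix.toLin'_toMatrix']
  change f (h (f v)) = f v
  rw [h1, h2]

/-- The function `u ↦ u ^ p` with the value `0` at `u = 0`, also for `p = 0`. -/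
noncomputable def lpEntryCost (p u : ℝ) : ℝ := if u = 0 then 0 else u ^ p

lemma lpEntryCost_of_ne_zero {p : ℝ} (hp : p ≠ 0) (u : ℝ) : lpEntryCost p u = u ^ p := by
  by_cases hu : u = 0 <;> simp [lpEntryCost, hu, hp]

lemma lpEntryCost_zero (u : ℝ) : lpEntryCost 0 u = if u = 0 then 0 else 1 := by
  simp [lpEntryCost]

lemma monotoneOn_lpEntryCost {p : ℝ} (hp0 : 0 ≤ p) :
    MonotoneOn (lpEntryCost p) (Set.Ici 0) := by
  intro u (hu : 0 ≤ u) v (hv : 0 ≤ v) huv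
  unfold lpEntryCost
  split_ifs with h1 h2 h2
  · exact le_rfl
  · positivity
  · exact absurd (le_antisymm (h2 ▸ huv) hu) h1
  · exact Real.rpow_le_rpow hu huv hp0

lemma concaveOn_lpEntryCost {p : ℝ} (hp0 : 0 ≤ p) (hp1 : p ≤ 1) :
    ConcaveOn ℝ (Set.Ici 0) (lpEntryCost p) := by
  rcases hp0.eq_or_lt with rfl | hp
  · refine ⟨convex_Ici 0, ?_⟩
    intro u (hu : 0 ≤ u) v (hv : 0 ≤ v) a b ha hb hab
    simp only [lpEntryCost_zero, smul_eq_mul]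
    by_cases h : a * u + b * v = 0
    · have h1 : a * u = 0 := by nlinarith [mul_nonneg ha hu, mul_nonneg hb hv]
      have h2 : b * v = 0 := by linarith
      rcases mul_eq_zero.mp h1 with h1 | h1 <;> rcases mul_eq_zero.mp h2 with h2 | h2 <;>
        simp [h1, h2]
    · rw [if_neg h]
      split_ifs <;> linarith
  · rw [funext (lpEntryCost_of_ne_zero hp.ne')]
    exact Real.concaveOn_rpow hp0 hp1

lemma matLpQNorm_le_of_sum_lpEntryCost_le {m n : ℕ} {p : ℝ} (hp0 : 0 ≤ p)
    {X Y : Matrix (Fin n) (Fin m) ℝ}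
    (h : ∑ ij : Fin n × Fin m, lpEntryCost p |X ij.1 ij.2| ≤
      ∑ ij : Fin n × Fin m, lpEntryCost p |Y ij.1 ij.2|) :
    matLpQNorm p X ≤ matLpQNorm p Y := by
  unfold matLpQNorm
  split_ifs with hp
  · subst hp
    have count (Z : Matrix (Fin n) (Fin m) ℝ) :
        ∑ ij : Fin n × Fin m, lpEntryCost 0 |Z ij.1 ij.2| =
          ((Finset.univ.filter fun ij : Fin n × Fin m => Z ij.1 ij.2 ≠ 0).card : ℝ) := by
      rw [Finset.card_filter]
      push_cast
      refine Finset.sum_congr rfl fun ij _ => ?_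
      by_cases hz : Z ij.1 ij.2 = 0 <;> simp [lpEntryCost_zero, hz]
    rwa [count, count] at h
  · simp only [lpEntryCost_of_ne_zero hp, Fintype.sum_prod_type] at h
    exact Real.rpow_le_rpow (by positivity) h (by positivity)

/-- The linear map `X ↦ A X A` on vectorized matrices. -/
def sandwichLin {m n : ℕ} (A : Matrix (Fin m) (Fin n) ℝ) :
    (Fin n × Fin m → ℝ) →ₗ[ℝ] Matrix (Fin m) (Fin n) ℝ where
  toFun x := A * Matrix.of (fun i j => x (i, j)) * A
  map_add' x y := by
    rw [← Matrix.add_mul, ← Matrix.mul_add]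
    rfl
  map_smul' c x := by
    rw [RingHom.id_apply, ← Matrix.smul_mul, ← Matrix.mul_smul]
    rfl

/-- For `A ∈ ℝ^{m×n}` with `m < n` and `0 ≤ p ≤ 1`, the set of
generalized inverses of `A` minimizing the entrywise `ℓ^p` norm contains a matrix `X`
with at most `m` non-zero entries in each column, hence at most `m²` non-zero entries
in total. -/
theorem ginv_lp_contains_sparse {m n : ℕ} (p : ℝ) (hp0 : 0 ≤ p) (hp1 : p ≤ 1)
    (hmn : m < n) (A : Matrix (Fin m) (Fin n) ℝ) :
    ∃ X : Matrix (Fin n) (Fin m) ℝ,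
      (IsGenInverse A X ∧
        ∀ Y : Matrix (Fin n) (Fin m) ℝ, IsGenInverse A Y → matLpQNorm p X ≤ matLpQNorm p Y) ∧
      (∀ j : Fin m, (Finset.univ.filter fun i => X i j ≠ 0).card ≤ m) ∧
      ((Finset.univ : Finset (Fin n × Fin m)).filter fun ij => X ij.1 ij.2 ≠ 0).card ≤ m ^ 2 := by
  have hconc := concaveOn_lpEntryCost hp0 hp1
  have hmono := monotoneOn_lpEntryCost hp0
  obtain ⟨X₀, hX₀⟩ := exists_isGenInverse A
  have lin_uncurry (Y : Matrix (Fin n) (Fin m) ℝ) :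
      sandwichLin A (fun ij => Y ij.1 ij.2) = A * Y * A := rfl
  obtain ⟨x, hLx, hx⟩ :=
    exists_cost_minimizer (sandwichLin A) hconc hmono (fun ij => X₀ ij.1 ij.2)
  rw [lin_uncurry, hX₀] at hLx hx
  choose y hy hcy hby using fun j : Fin m =>
    exists_isBasicVector_cost_le A.mulVecLin hconc hmono (fun i => x (i, j))
  have hcol (j : Fin m) : (Finset.univ.filter fun i => y j i ≠ 0).card ≤ m := by
    simpa using (hby j).card_support_le_finrank
  refine ⟨Matrix.of fun i j => y j i, ⟨?_, fun Y hY => ?_⟩, hcol, ?_⟩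
  · have : A * Matrix.of (fun i j => y j i) = A * Matrix.of (fun i j => x (i, j)) := by
      ext i j
      exact congrFun (hy j) i
    rw [IsGenInverse, this]
    exact hLx
  · refine matLpQNorm_le_of_sum_lpEntryCost_le hp0 (le_trans ?_ (hx (fun ij => Y ij.1 ij.2) hY))
    rw [Fintype.sum_prod_type_right, Fintype.sum_prod_type_right]
    exact Finset.sum_le_sum fun j _ => hcy j
  · calc _ = ∑ j : Fin m, (Finset.univ.filter fun i => y j i ≠ 0).card := by
          rw [Finset.card_filter, Fintype.sum_prod_type_right]
          simp only [Finset.card_filter]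
          rfl
      _ ≤ ∑ _j : Fin m, m := Finset.sum_le_sum fun j _ => hcol j
      _ = m ^ 2 := by simp [sq]
end

section
/- Let F(m,n) denote the set of full-rank matrices in R^{m×n} with m < n. The set of matrices A ∈ F(m,n) for which the set ginv_1(A) of ℓ^1-norm-minimizing generalized inverses does not intersect the set ginv_0(A) of generalized inverses with minimal number of non-zero entries has Lebesgue measure zero in R^{m×n}. -/
/-- `X` minimizes the entrywise `ℓ^1` norm among generalized inverses of `A`. -/
def MemGinv1 {m n : ℕ} (A : Matrix (Fin m) (Fin n) ℝ) (X : Matrix (Fin n) (Fin m) ℝ) :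
    Prop :=
  IsGenInverse A X ∧
    ∀ Y : Matrix (Fin n) (Fin m) ℝ, IsGenInverse A Y → ∑ i, ∑ j, |X i j| ≤ ∑ i, ∑ j, |Y i j|

/-- `X` minimizes the number of non-zero entries among generalized inverses of `A`. -/
def MemGinv0 {m n : ℕ} (A : Matrix (Fin m) (Fin n) ℝ) (X : Matrix (Fin n) (Fin m) ℝ) :
    Prop :=
  IsGenInverse A X ∧
    ∀ Y : Matrix (Fin n) (Fin m) ℝ, IsGenInverse A Y →
      ((Finset.univ : Finset (Fin n × Fin m)).filter fun ij => X ij.1 ij.2 ≠ 0).card ≤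
        ((Finset.univ : Finset (Fin n × Fin m)).filter fun ij => Y ij.1 ij.2 ≠ 0).card

theorem IsGenInverse.mul_eq_one {m n : ℕ} {A : Matrix (Fin m) (Fin n) ℝ}
    {R X : Matrix (Fin n) (Fin m) ℝ} (hR : A * R = 1) (hX : IsGenInverse A X) : A * X = 1 := by
  have h : A * X * A * R = A * R := congrArg (· * R) hX
  rwa [Matrix.mul_assoc, hR, Matrix.mul_one] at h

/-- A matrix of full row rank has a right inverse. -/
theorem exists_mul_eq_one_of_rank_eq {m n : ℕ} {A : Matrix (Fin m) (Fin n) ℝ}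
    (hA : A.rank = m) : ∃ R : Matrix (Fin n) (Fin m) ℝ, A * R = 1 := by
  rw [← Matrix.mulVec_surjective_iff_exists_right_inverse]
  have h : LinearMap.range A.mulVecLin = ⊤ :=
    Submodule.eq_top_of_finrank_eq (by rw [← Matrix.rank, hA, Module.finrank_fin_fun])
  exact LinearMap.range_eq_top.1 h

open Matrix in
/-- A vector with more than `m` non-zero entries dominates a non-trivial element of the kernel
of any matrix with `m` rows. -/
theorem exists_mulVec_eq_zero_of_card_lt {m n : ℕ} (A : Matrix (Fin m) (Fin n) ℝ) (x : Fin n → ℝ)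
    (hx : m < (Finset.univ.filter fun i => x i ≠ 0).card) :
    ∃ z : Fin n → ℝ, z ≠ 0 ∧ A *ᵥ z = 0 ∧ ∀ i, x i = 0 → z i = 0 := by
  let L := A.mulVecLin.prod (LinearMap.funLeft ℝ ℝ (Subtype.val : {i // x i = 0} → Fin n))
  have hL : LinearMap.ker L ≠ ⊥ := by
    apply LinearMap.ker_ne_bot_of_finrank_lt
    have h := Finset.card_filter_add_card_filter_not (s := Finset.univ) (fun i => x i = 0)
    simp only [Module.finrank_prod, Module.finrank_fintype_fun_eq_card,
      Fintype.card_subtype, Finset.card_univ, Fintype.card_fin] at h ⊢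
    simp only [ne_eq] at hx
    omega
  obtain ⟨z, hz, hz0⟩ := Submodule.exists_mem_ne_zero_of_ne_bot hL
  have hz' : A *ᵥ z = 0 ∧ (fun i : {i // x i = 0} => z i) = 0 := by
    simpa [L, LinearMap.mem_ker, Prod.ext_iff, LinearMap.funLeft, Function.comp_def] using hz
  exact ⟨z, hz0, hz'.1, fun i hi => congrFun hz'.2 ⟨i, hi⟩⟩

theorem abs_add_add_abs_sub_of_abs_le {a b : ℝ} (h : |b| ≤ |a|) : |a + b| + |a - b| = 2 * |a| := by
  have := abs_le.1 h
  rcases abs_cases a with ha | ha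
  · rw [abs_of_nonneg (a := a + b) (by linarith), abs_of_nonneg (a := a - b) (by linarith)]
    linarith
  · rw [abs_of_nonpos (a := a + b) (by linarith), abs_of_nonpos (a := a - b) (by linarith)]
    linarith

open Matrix in
/-- A solvable linear system has a solution of minimal `ℓ^1` norm. -/
theorem exists_l1_minimizer {m n : ℕ} (A : Matrix (Fin m) (Fin n) ℝ) {b : Fin m → ℝ}
    {x₀ : Fin n → ℝ} (hx₀ : A *ᵥ x₀ = b) :
    ∃ x, A *ᵥ x = b ∧ ∀ y, A *ᵥ y = b → ∑ i, |x i| ≤ ∑ i, |y i| := by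
  have hclosed : IsClosed {x | A *ᵥ x = b} :=
    isClosed_eq (continuous_const.matrix_mulVec continuous_id) continuous_const
  have hcont : Continuous fun x : Fin n → ℝ => ∑ i, |x i| := by fun_prop
  have hnorm (x : Fin n → ℝ) : ‖x‖ ≤ ∑ i, |x i| :=
    (pi_norm_le_iff_of_nonneg (Finset.sum_nonneg fun i _ => abs_nonneg (x i))).2 fun i =>
      Finset.single_le_sum (f := fun i => |x i|) (fun i _ => abs_nonneg (x i)) (Finset.mem_univ i)
  have hlim : Filter.Tendsto (fun x : Fin n → ℝ => ∑ i, |x i|) (Filter.cocompact _) Filter.atTop :=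
    Filter.tendsto_atTop_mono hnorm tendsto_norm_cocompact_atTop
  obtain ⟨x, hx, hmin⟩ := hcont.continuousOn.exists_isMinOn' hclosed hx₀
    (Filter.Eventually.filter_mono inf_le_left (hlim.eventually_ge_atTop _))
  exact ⟨x, hx, fun y hy => hmin hy⟩

open Matrix in
/-- A solvable linear system of `m` equations has a solution of minimal `ℓ^1` norm with at most
`m` non-zero entries. -/
theorem exists_l1_minimizer_card_le {m n : ℕ} (A : Matrix (Fin m) (Fin n) ℝ) {b : Fin m → ℝ}
    {x₀ : Fin n → ℝ} (hx₀ : A *ᵥ x₀ = b) :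
    ∃ x, A *ᵥ x = b ∧ (∀ y, A *ᵥ y = b → ∑ i, |x i| ≤ ∑ i, |y i|) ∧
      (Finset.univ.filter fun i => x i ≠ 0).card ≤ m := by
  obtain ⟨x, ⟨hxb, hxmin⟩, hcard⟩ := exists_minimalFor_of_wellFoundedLT
    (fun x => A *ᵥ x = b ∧ ∀ y, A *ᵥ y = b → ∑ i, |x i| ≤ ∑ i, |y i|)
    (fun x => (Finset.univ.filter fun i => x i ≠ 0).card) (exists_l1_minimizer A hx₀)
  refine ⟨x, hxb, hxmin, ?_⟩
  by_contra! hlt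
  obtain ⟨z, hz0, hAz, hzx⟩ := exists_mulVec_eq_zero_of_card_lt A x hlt
  obtain ⟨k₀, hk₀⟩ := Function.ne_iff.1 hz0
  obtain ⟨k, hk, hkmin⟩ := (Finset.univ.filter fun i => z i ≠ 0).exists_min_image
    (fun i => |x i| / |z i|) ⟨k₀, by simpa using hk₀⟩
  replace hk : z k ≠ 0 := by simpa using hk
  obtain ⟨t, ht⟩ : ∃ t, t = -x k / z k := ⟨_, rfl⟩
  have hle (i) : |t * z i| ≤ |x i| := by
    by_cases hi : z i = 0
    · simp [hi]
    · have := hkmin i (by simpa using hi)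
      rw [abs_mul, ht, abs_div, abs_neg]
      exact (le_div_iff₀ (abs_pos.2 hi)).1 this
  have hadd (s : ℝ) : A *ᵥ (x + s • z) = b := by
    rw [Matrix.mulVec_add, Matrix.mulVec_smul, hAz, hxb, smul_zero, add_zero]
  have hsum : ∑ i, |(x + t • z) i| + ∑ i, |(x + (-t) • z) i| = 2 * ∑ i, |x i| := by
    rw [← Finset.sum_add_distrib, Finset.mul_sum]
    refine Finset.sum_congr rfl fun i _ => ?_
    rw [← abs_add_add_abs_sub_of_abs_le (hle i)]
    simp [sub_eq_add_neg]
  have hmin' : ∀ y, A *ᵥ y = b → ∑ i, |(x + t • z) i| ≤ ∑ i, |y i| := fun y hy => by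
    have h₁ := hxmin _ (hadd (-t))
    have h₂ := hxmin y hy
    linarith
  have hlt' : (Finset.univ.filter fun i => (x + t • z) i ≠ 0).card <
      (Finset.univ.filter fun i => x i ≠ 0).card := Finset.card_lt_card ?_
  · exact hlt'.not_ge (hcard ⟨hadd t, hmin'⟩ hlt'.le)
  refine (Finset.ssubset_iff_of_subset ?_).2 ⟨k, ?_, ?_⟩
  · intro i hi
    simp only [Finset.mem_filter, Finset.mem_univ, true_and] at hi ⊢
    contrapose! hi
    simp [hi, hzx i hi]
  · simpa using fun h => hk (hzx k h)
  · simp [ht, hk]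

open Matrix in
/-- If `A y = e_j` has a solution with fewer than `m` non-zero entries, then replacing a column of
a suitable `m × m` submatrix of `A` by `e_j` yields a singular matrix. -/
theorem exists_det_updateCol_eq_zero {m n : ℕ} (hmn : m ≤ n) (A : Matrix (Fin m) (Fin n) ℝ)
    {j : Fin m} {y : Fin n → ℝ} (hy : A *ᵥ y = Pi.single j 1)
    (hcard : (Finset.univ.filter fun i => y i ≠ 0).card < m) :
    ∃ (f : Fin m ↪ Fin n) (k : Fin m),
      ((A.submatrix id f).updateCol k (Pi.single j 1)).det = 0 := by
  obtain ⟨t, hyt, ht⟩ := Finset.exists_superset_card_eq hcard.le (by simpa using hmn)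
  obtain ⟨a, hat, ha⟩ := Finset.exists_mem_notMem_of_card_lt_card (hcard.trans_eq ht.symm)
  replace ha : y a = 0 := by simpa using ha
  have hrange := Finset.range_orderEmbOfFin t ht
  obtain ⟨k, rfl⟩ : a ∈ Set.range (t.orderEmbOfFin ht) := by rw [hrange]; exact hat
  refine ⟨(t.orderEmbOfFin ht).toEmbedding, k, ?_⟩
  rw [← Matrix.exists_mulVec_eq_zero_iff]
  refine ⟨Function.update (fun l => y (t.orderEmbOfFin ht l)) k (-1), fun h => ?_, ?_⟩
  · simpa using congrFun h k
  ext i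
  have hterm (l : Fin m) : (A.submatrix id (t.orderEmbOfFin ht)).updateCol k (Pi.single j 1) i l *
      Function.update (fun l => y (t.orderEmbOfFin ht l)) k (-1) l =
      A i (t.orderEmbOfFin ht l) * y (t.orderEmbOfFin ht l) -
        if l = k then (Pi.single j 1 : Fin m → ℝ) i else 0 := by
    by_cases hl : l = k
    · subst hl; simp [ha]
    · simp [hl]
  have hsum : ∑ l, A i (t.orderEmbOfFin ht l) * y (t.orderEmbOfFin ht l) =
      (Pi.single j 1 : Fin m → ℝ) i := by
    rw [← hy, Matrix.mulVec, dotProduct]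
    refine Fintype.sum_of_injective _ (t.orderEmbOfFin ht).injective _ _
      (fun a ha => ?_) (fun _ => rfl)
    rw [hrange] at ha
    have : y a = 0 := by
      by_contra h
      exact ha (hyt (by simpa using h))
    simp [this]
  change ∑ l, (A.submatrix id (t.orderEmbOfFin ht)).updateCol k (Pi.single j 1) i l *
      Function.update (fun l => y (t.orderEmbOfFin ht l)) k (-1) l = 0
  simp_rw [hterm]
  rw [Finset.sum_sub_distrib, hsum]
  simp

open Matrix Polynomial in
/-- If `P` is nonsingular, then `Q + t P` is nonsingular for almost every `t`. -/
theorem ae_det_add_smul_ne_zero {m : ℕ} {P : Matrix (Fin m) (Fin m) ℝ} (hP : P.det ≠ 0)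
    (Q : Matrix (Fin m) (Fin m) ℝ) : ∀ᵐ t : ℝ, (Q + t • P).det ≠ 0 := by
  have hp : det ((X : ℝ[X]) • P.map C + Q.map C) ≠ 0 := fun h => hP <| by
    rw [← coeff_det_X_add_C_card P Q, h, coeff_zero]
  have hfin := (Polynomial.finite_setOfPred_isRoot hp).countable.ae_notMem MeasureTheory.volume
  filter_upwards [hfin] with t ht h
  refine ht ?_
  rw [IsRoot.def, ← coe_evalRingHom, RingHom.map_det, ← h]
  congr 1
  ext i l
  simp [add_comm (Q i l), mul_comm t]

open Matrix in
/-- Replacing a column of a square submatrix of a generic matrix by a standard basis vector yields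
a nonsingular matrix. -/
theorem ae_det_updateCol_ne_zero {m n : ℕ} (f : Fin m ↪ Fin n) (k j : Fin m) :
    ∀ᵐ A : Fin m → Fin n → ℝ,
      (((Matrix.of A).submatrix id f).updateCol k (Pi.single j 1)).det ≠ 0 := by
  let σ : Equiv.Perm (Fin m) := Equiv.swap j k
  let B : Fin m → Fin n → ℝ := fun i a => if a = f (σ i) then 1 else 0
  let P : Matrix (Fin m) (Fin m) ℝ := (Matrix.of B).submatrix id f
  have hPe : P = (1 : Matrix (Fin m) (Fin m) ℝ).submatrix σ id := by
    ext i l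
    simp [P, B, Matrix.one_apply, eq_comm]
  have hP : P.det ≠ 0 := by
    rw [hPe, Matrix.det_permute]
    simp
  have hPk (i : Fin m) : P i k = (Pi.single j 1 : Fin m → ℝ) i := by
    rw [hPe, Matrix.submatrix_apply, Matrix.one_apply, Pi.single_apply]
    simp [σ, Equiv.swap_apply_eq_iff]
  refine MeasureTheory.ae_mem_of_ae_add_linearMap_mem (LinearMap.toSpanSingleton ℝ _ B)
    MeasureTheory.volume MeasureTheory.volume
    (s := {A | (((Matrix.of A).submatrix id f).updateCol k (Pi.single j 1)).det ≠ 0}) ?_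
    fun A => ?_
  · refine (isOpen_ne_fun ?_ continuous_const).measurableSet
    refine Continuous.matrix_det (Continuous.matrix_updateCol k ?_ continuous_const)
    exact Continuous.matrix_submatrix continuous_id id f
  · filter_upwards [ae_det_add_smul_ne_zero hP
      (((Matrix.of A).submatrix id f).updateCol k 0)] with t ht hzero
    refine ht ?_
    have hcol : ((Matrix.of A).submatrix id f).updateCol k 0 + t • P =
        ((Matrix.of (A + t • B)).submatrix id f).updateCol k (t • Pi.single j 1) := by
      ext i l
      by_cases hl : l = k
      · subst hl; simp [hPk]
      · simp [hl, P]
    rw [hcol, Matrix.det_updateCol_smul]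
    exact mul_eq_zero_of_right _ hzero

theorem card_filter_prod_eq_sum {m n : ℕ} (X : Matrix (Fin n) (Fin m) ℝ) :
    ((Finset.univ : Finset (Fin n × Fin m)).filter fun ij => X ij.1 ij.2 ≠ 0).card =
      ∑ j, (Finset.univ.filter fun i => X i j ≠ 0).card := by
  simp_rw [Finset.card_filter]
  rw [Fintype.sum_prod_type_right]

open Matrix in
theorem mul_eq_one_iff_mulVec_col {m n : ℕ} {A : Matrix (Fin m) (Fin n) ℝ}
    {X : Matrix (Fin n) (Fin m) ℝ} :
    A * X = 1 ↔ ∀ j, A *ᵥ (fun i => X i j) = Pi.single j 1 := by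
  rw [← Matrix.ext_iff, forall_comm]
  simp only [funext_iff, Matrix.mul_apply, Matrix.mulVec, dotProduct, Matrix.one_apply,
    Pi.single_apply]

/-- The set of full-rank matrices `A ∈ ℝ^{m×n}` (`m < n`) for which the set
of `ℓ^1`-norm-minimizing generalized inverses does not intersect the set of generalized
inverses with minimal number of non-zero entries has Lebesgue measure zero (under the
identification of `ℝ^{m×n}` with `ℝ^{mn}`). -/
theorem spinv_intersects_sparsest_ae {m n : ℕ} (hmn : m < n) :
    MeasureTheory.volume
      {A : Fin m → Fin n → ℝ |
        (Matrix.of A).rank = m ∧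
        ¬∃ X : Matrix (Fin n) (Fin m) ℝ, MemGinv1 (Matrix.of A) X ∧ MemGinv0 (Matrix.of A) X} =
      0 := by
  have hae : ∀ᵐ A : Fin m → Fin n → ℝ, ∀ (f : Fin m ↪ Fin n) (k j : Fin m),
      (((Matrix.of A).submatrix id f).updateCol k (Pi.single j 1)).det ≠ 0 := by
    simp only [MeasureTheory.ae_all_iff]
    exact ae_det_updateCol_ne_zero
  refine MeasureTheory.measure_mono_null ?_ (MeasureTheory.ae_iff.1 hae)
  rintro A ⟨hrank, hA⟩ hdet
  refine hA ?_
  obtain ⟨R, hR⟩ := exists_mul_eq_one_of_rank_eq hrank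
  choose x hx hmin hcard using fun j =>
    exists_l1_minimizer_card_le (Matrix.of A) (mul_eq_one_iff_mulVec_col.1 hR j)
  have hinv : IsGenInverse (Matrix.of A) (Matrix.of fun i j => x j i) := by
    have h : Matrix.of A * Matrix.of (fun i j => x j i) = 1 := mul_eq_one_iff_mulVec_col.2 hx
    rw [IsGenInverse, h, Matrix.one_mul]
  refine ⟨_, ⟨hinv, fun Y hY => ?_⟩, hinv, fun Y hY => ?_⟩
  · rw [Finset.sum_comm, Finset.sum_comm (f := fun i j => |Y i j|)]
    exact Finset.sum_le_sum fun j _ =>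
      hmin j _ (mul_eq_one_iff_mulVec_col.1 (hY.mul_eq_one hR) j)
  · rw [card_filter_prod_eq_sum, card_filter_prod_eq_sum]
    refine Finset.sum_le_sum fun j _ => (hcard j).trans ?_
    by_contra! hlt
    obtain ⟨f, k, h⟩ := exists_det_updateCol_eq_zero hmn.le (Matrix.of A)
      (mul_eq_one_iff_mulVec_col.1 (hY.mul_eq_one hR) j) hlt
    exact hdet f k j h
end

section
/- Assume A ∈ R^{m×n} (m < n) has columns in general position and is in general position with respect to each canonical basis vector e_1,…,e_m of R^m. Then the set ginv_1(A) of ℓ^1-norm-minimizing generalized inverses of A contains exactly one matrix, and every column of this matrix has exactly m non-zero entries. -/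
/-- `x` has minimal `ℓ^1` norm among the solutions of `A x = y`. -/
def IsL1MinSolution {m n : ℕ} (A : Matrix (Fin m) (Fin n) ℝ) (y : Fin m → ℝ)
    (x : Fin n → ℝ) : Prop :=
  A.mulVec x = y ∧ ∀ z : Fin n → ℝ, A.mulVec z = y → ∑ i, |x i| ≤ ∑ i, |z i|

/-- Any `m + 1` signed columns of a matrix with columns in general position are affinely
independent. -/
theorem ColsInGeneralPosition.eq_zero_of_sum_eq_zero {m n : ℕ} {A : Matrix (Fin m) (Fin n) ℝ}
    (hA : ColsInGeneralPosition A) {T : Finset (Fin n)} (hT : T.card = m + 1)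
    {σ : Fin n → ℝ} (hσ : ∀ j, σ j = 1 ∨ σ j = -1) {c : Fin n → ℝ}
    (hcT : ∀ i ∉ T, c i = 0) (hc : ∑ i, c i = 0)
    (hAc : A.mulVec (fun i => c i * σ i) = 0) : c = 0 := by
  by_contra hne
  obtain ⟨i, hi⟩ := Function.ne_iff.mp hne
  simp only [Pi.zero_apply] at hi
  have hiT : i ∈ T := by
    by_contra h
    exact hi (hcT i h)
  have hsum : ∀ f : Fin n → ℝ, (∀ j ∉ T, f j = 0) → ∑ j, f j = f i + ∑ j ∈ T.erase i, f j := by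
    intro f hf
    rw [Finset.add_sum_erase T f hiT]
    exact (Finset.sum_subset (Finset.subset_univ T) fun j _ hj => hf j hj).symm
  have hcard : (T.erase i).card = m := by
    rw [Finset.card_erase_of_mem hiT, hT, Nat.add_sub_cancel]
  have hw : ∑ j ∈ T.erase i, -c j / c i = 1 := by
    rw [← Finset.sum_div, Finset.sum_neg_distrib, div_eq_one_iff_eq hi]
    linarith [hsum c hcT]
  have hm : 0 < m := by
    rcases Nat.eq_zero_or_pos m with h0 | h0
    · rw [Finset.card_eq_zero.mp (hcard.trans h0)] at hw
      simp at hw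
    · exact h0
  refine hA (m - 1) (by omega) (T.erase i) (by omega) σ hσ i (Finset.notMem_erase i T) (σ i)
    (hσ i) ?_
  have hmem := affineCombination_mem_affineSpan_image (k := ℝ) (s := T.erase i)
    (w := fun j => -c j / c i) hw (s' := ↑(T.erase i)) (fun j hj hj' => absurd hj hj')
    (fun j => σ j • fun r => A r j)
  rw [Finset.affineCombination_eq_linear_combination _ _ _ hw] at hmem
  convert hmem using 1
  ext r
  have hr := congrFun hAc r
  simp only [Matrix.mulVec, dotProduct, Pi.zero_apply] at hr
  rw [hsum (fun j => A r j * (c j * σ j)) fun j hj => by simp [hcT j hj]] at hr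
  simp only [Pi.smul_apply, smul_eq_mul, Finset.sum_apply]
  have h2 : ∑ j ∈ T.erase i, -c j / c i * (σ j * A r j)
      = -(∑ j ∈ T.erase i, A r j * (c j * σ j)) / c i := by
    rw [← Finset.sum_neg_distrib, Finset.sum_div]
    exact Finset.sum_congr rfl fun j _ => by ring
  rw [h2, eq_div_iff hi]
  linarith

theorem ColsInGeneralPosition.mulVec_surjective {m n : ℕ} {A : Matrix (Fin m) (Fin n) ℝ}
    (hA : ColsInGeneralPosition A) (hmn : m < n) : Function.Surjective A.mulVec := by
  obtain ⟨T, -, hT⟩ := Finset.exists_subset_card_eq (s := (Finset.univ : Finset (Fin n)))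
    (n := m + 1) (by simpa using hmn)
  let E : (T → ℝ) →ₗ[ℝ] (Fin n → ℝ) := Function.ExtendByZero.linearMap ℝ Subtype.val
  have hE : Function.Injective E := fun a b h => by
    ext j
    simpa [E, Subtype.val_injective.extend_apply] using congrFun h j
  let S : (Fin n → ℝ) →ₗ[ℝ] ℝ := ∑ i, LinearMap.proj i
  have hS : ∀ c, S c = ∑ i, c i := fun c => by simp [S]
  let F : (T → ℝ) →ₗ[ℝ] (Fin m → ℝ) × ℝ := (A.mulVecLin.prod S).comp E
  have hF : Function.Injective F := by
    rw [injective_iff_map_eq_zero]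
    intro c hc
    apply hE
    rw [map_zero]
    have h1 : A.mulVec (E c) = 0 := congrArg Prod.fst hc
    have h2 : S (E c) = 0 := congrArg Prod.snd hc
    refine hA.eq_zero_of_sum_eq_zero hT (σ := fun _ => 1) (fun _ => Or.inl rfl) ?_
      ((hS _).symm.trans h2) (by simpa using h1)
    intro i hi
    exact Function.extend_apply' _ _ _ (by rintro ⟨j, rfl⟩; exact hi j.2)
  have hsurj := (LinearMap.injective_iff_surjective_of_finrank_eq_finrank
    (f := F) (by simp [hT])).mp hF
  intro y
  obtain ⟨c, hc⟩ := hsurj (y, 0)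
  exact ⟨E c, congrArg Prod.fst hc⟩

theorem InGeneralPositionWrt.le_card_support {m n : ℕ} {A : Matrix (Fin m) (Fin n) ℝ}
    {y : Fin m → ℝ} (hy : InGeneralPositionWrt A y) {x : Fin n → ℝ} (hx : A.mulVec x = y) :
    m ≤ (Finset.univ.filter fun i => x i ≠ 0).card := by
  by_contra! h
  refine hy _ h _ rfl ?_
  have hsum : y = ∑ i, x i • fun r => A r i := by
    ext r
    simp [← hx, Matrix.mulVec, dotProduct, mul_comm]
  rw [hsum]
  refine Submodule.sum_mem _ fun i _ => ?_
  by_cases hi : x i = 0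
  · simp [hi]
  · exact Submodule.smul_mem _ _ (Submodule.subset_span ⟨i, by simpa using hi, rfl⟩)

theorem IsL1MinSolution.card_support_le {m n : ℕ} {A : Matrix (Fin m) (Fin n) ℝ}
    (hA : ColsInGeneralPosition A) {y : Fin m → ℝ} {x : Fin n → ℝ}
    (hx : IsL1MinSolution A y x) : (Finset.univ.filter fun i => x i ≠ 0).card ≤ m := by
  by_contra! h
  obtain ⟨T, hTx, hT⟩ := Finset.exists_subset_card_eq (Nat.succ_le_of_lt h)
  have hxT : ∀ i ∈ T, x i ≠ 0 := fun i hi => by simpa using hTx hi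
  let E : (T → ℝ) →ₗ[ℝ] (Fin n → ℝ) := Function.ExtendByZero.linearMap ℝ Subtype.val
  have hE : Function.Injective E := fun a b h => by
    ext j
    simpa [E, Subtype.val_injective.extend_apply] using congrFun h j
  have hker : LinearMap.ker (A.mulVecLin.comp E) ≠ ⊥ :=
    LinearMap.ker_ne_bot_of_finrank_lt (by simp [hT])
  obtain ⟨d, hd, hd0⟩ := (Submodule.ne_bot_iff _).mp hker
  have hAd : A.mulVec (E d) = 0 := hd
  have hdT : ∀ i ∉ T, E d i = 0 := fun i hi =>
    Function.extend_apply' _ _ _ (by rintro ⟨j, rfl⟩; exact hi j.2)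
  have hEd : E d ≠ 0 := fun h0 => hd0 (hE (h0.trans (map_zero E).symm))
  generalize E d = v at hAd hdT hEd
  let σ : Fin n → ℝ := fun i => if 0 ≤ x i then 1 else -1
  have hσ : ∀ i, σ i = 1 ∨ σ i = -1 := fun i => ite_eq_or_eq _ _ _
  have hσσ : ∀ i, σ i * σ i = 1 := fun i => by rcases hσ i with h | h <;> simp [h]
  have hne : ∑ i, σ i * v i ≠ 0 := by
    intro h0
    have := hA.eq_zero_of_sum_eq_zero hT hσ (c := fun i => σ i * v i)
      (fun i hi => by simp [hdT i hi]) h0 (by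
        convert hAd using 2
        ext i
        linear_combination v i * hσσ i)
    apply hEd
    ext i
    have hi := congrFun this i
    simp only [Pi.zero_apply] at hi ⊢
    linear_combination σ i * hi - v i * hσσ i
  have hsmall : ∀ᶠ t in nhds (0 : ℝ), ∀ i, |x i + t * v i| = |x i| + t * (σ i * v i) := by
    rw [Filter.eventually_all]
    intro i
    by_cases hi : i ∈ T
    · have hcont : Filter.Tendsto (fun t : ℝ => x i + t * v i) (nhds 0) (nhds (x i)) := by
        have : Continuous fun t : ℝ => x i + t * v i := by fun_prop
        simpa using this.tendsto 0
      rcases (hxT i hi).lt_or_gt with hlt | hgt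
      · filter_upwards [hcont.eventually_lt_const hlt] with t ht
        simp only [σ, abs_of_neg ht, abs_of_neg hlt, if_neg hlt.not_ge]
        ring
      · filter_upwards [hcont.eventually_const_lt hgt] with t ht
        simp only [σ, abs_of_pos ht, abs_of_pos hgt, if_pos hgt.le]
        ring
    · simp [hdT i hi]
  obtain ⟨ε, hε, hball⟩ := Metric.eventually_nhds_iff.mp hsmall
  have key : ∀ t : ℝ, |t| < ε → 0 ≤ t * ∑ i, σ i * v i := by
    intro t ht
    have hle := hx.2 (fun i => x i + t * v i) (by
      have : (fun i => x i + t * v i) = x + t • v := rfl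
      rw [this, Matrix.mulVec_add, Matrix.mulVec_smul, hAd, hx.1]
      simp)
    have heq := hball (y := t) (by simpa using ht)
    simp only [heq, Finset.sum_add_distrib, ← Finset.mul_sum] at hle
    linarith
  have h1 := key (ε / 2) (by rw [abs_of_pos] <;> linarith)
  have h2 := key (-(ε / 2)) (by rw [abs_neg, abs_of_pos] <;> linarith)
  rcases mul_eq_zero.mp (le_antisymm (by linarith) h1) with h3 | h3
  · linarith
  · exact hne h3

theorem IsL1MinSolution.eq {m n : ℕ} {A : Matrix (Fin m) (Fin n) ℝ}
    (hA : ColsInGeneralPosition A) {y : Fin m → ℝ} (hy : InGeneralPositionWrt A y)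
    {x z : Fin n → ℝ} (hx : IsL1MinSolution A y x) (hz : IsL1MinSolution A y z) : z = x := by
  by_contra hne
  obtain ⟨i, hi⟩ := Function.ne_iff.mp hne
  have hxz : ∑ i, |x i| = ∑ i, |z i| := le_antisymm (hx.2 z hz.1) (hz.2 x hx.1)
  let w : Fin n → ℝ := (1 / 2 : ℝ) • (x + z)
  have hAw : A.mulVec w = y := by
    rw [Matrix.mulVec_smul, Matrix.mulVec_add, hx.1, hz.1, ← two_smul ℝ, smul_smul]
    norm_num
  have hwle : ∀ i, |w i| ≤ (|x i| + |z i|) / 2 := fun i => by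
    simp only [w, Pi.smul_apply, Pi.add_apply, smul_eq_mul, abs_mul]
    rw [abs_of_pos (by norm_num : (0 : ℝ) < 1 / 2)]
    linarith [abs_add_le (x i) (z i)]
  have hmid : ∑ i, (|x i| + |z i|) / 2 = ∑ i, |x i| := by
    rw [← Finset.sum_div, Finset.sum_add_distrib, ← hxz]
    ring
  have hw : IsL1MinSolution A y w := ⟨hAw, fun u hu =>
    ((Finset.sum_le_sum fun i _ => hwle i).trans_eq hmid).trans (hx.2 u hu)⟩
  have hweq : ∀ i, |w i| = (|x i| + |z i|) / 2 := fun i =>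
    (Finset.sum_eq_sum_iff_of_le fun i _ => hwle i).mp
      (le_antisymm (Finset.sum_le_sum fun i _ => hwle i) (hmid.trans_le (hx.2 w hAw)))
      i (Finset.mem_univ i)
  have hw0 : ∀ j, w j = 0 → x j = 0 ∧ z j = 0 := fun j hj => by
    have h := hweq j
    rw [hj, abs_zero] at h
    have h1 := abs_nonneg (x j)
    have h2 := abs_nonneg (z j)
    exact ⟨abs_eq_zero.mp (by linarith), abs_eq_zero.mp (by linarith)⟩
  have hsub : z i - x i ≠ 0 := sub_ne_zero.mpr hi
  generalize w = w at hAw hw hw0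
  let u : Fin n → ℝ := w - (w i / (z i - x i)) • (z - x)
  have hu : A.mulVec u = y := by
    rw [Matrix.mulVec_sub, Matrix.mulVec_smul, Matrix.mulVec_sub, hx.1, hz.1, hAw]
    simp
  have hlt : (Finset.univ.filter fun j => u j ≠ 0).card
      < (Finset.univ.filter fun j => w j ≠ 0).card := by
    apply Finset.card_lt_card
    rw [Finset.ssubset_iff_of_subset]
    · refine ⟨i, ?_, ?_⟩
      · simp only [Finset.mem_filter, Finset.mem_univ, true_and]
        exact fun h => hi ((hw0 i h).2.trans (hw0 i h).1.symm)
      · simp [u, div_mul_cancel₀ _ hsub]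
    · intro j
      simp only [Finset.mem_filter, Finset.mem_univ, true_and]
      exact mt fun h => by simp [u, h, hw0 j h]
  exact absurd (hy.le_card_support hu) (not_le.mpr (hlt.trans_le (hw.card_support_le hA)))

theorem exists_isL1MinSolution {m n : ℕ} {A : Matrix (Fin m) (Fin n) ℝ} {y : Fin m → ℝ}
    (h : ∃ x, A.mulVec x = y) : ∃ x, IsL1MinSolution A y x := by
  obtain ⟨x₀, hx₀⟩ := h
  let f : (Fin n → ℝ) → ℝ := fun x => ∑ i, |x i|
  have hf : Continuous f := by fun_prop
  let K : Set (Fin n → ℝ) := {x | A.mulVec x = y} ∩ {x | f x ≤ f x₀}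
  have hK : IsCompact K := by
    refine (isCompact_closedBall (0 : Fin n → ℝ) (f x₀)).of_isClosed_subset
      ((isClosed_eq (by fun_prop) continuous_const).inter (isClosed_le hf continuous_const)) ?_
    rintro x ⟨-, hx⟩
    rw [mem_closedBall_zero_iff, pi_norm_le_iff_of_nonneg
      (Finset.sum_nonneg fun i _ => abs_nonneg (x₀ i))]
    exact fun i => (Finset.single_le_sum (f := fun i => |x i|) (fun i _ => abs_nonneg _)
      (Finset.mem_univ i)).trans hx
  obtain ⟨x, hxK, hx⟩ := hK.exists_isMinOn ⟨x₀, hx₀, le_refl (f x₀)⟩ hf.continuousOn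
  refine ⟨x, hxK.1, fun z hz => ?_⟩
  rcases le_total (f z) (f x₀) with h | h
  · exact hx ⟨hz, h⟩
  · exact hxK.2.trans h

theorem isGenInverse_iff_mulVec_col {m n : ℕ} {A : Matrix (Fin m) (Fin n) ℝ}
    (hA : Function.Surjective A.mulVec) (X : Matrix (Fin n) (Fin m) ℝ) :
    IsGenInverse A X ↔
      ∀ j, A.mulVec (fun i => X i j) = fun r => if r = j then 1 else 0 := by
  have hcol : A * X = 1 ↔
      ∀ j, A.mulVec (fun i => X i j) = fun r => if r = j then 1 else 0 := by
    simp only [← Matrix.ext_iff, funext_iff, Matrix.one_apply]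
    exact forall_comm
  rw [← hcol]
  refine ⟨fun h => ?_, fun h => ?_⟩
  · apply Matrix.mulVec_injective
    ext1 v
    obtain ⟨u, rfl⟩ := hA v
    rw [Matrix.mulVec_mulVec, h, Matrix.one_mulVec]
  · rw [IsGenInverse, h, Matrix.one_mul]

theorem memGinv1_iff_isL1MinSolution_col {m n : ℕ} {A : Matrix (Fin m) (Fin n) ℝ}
    (hA : Function.Surjective A.mulVec) (X : Matrix (Fin n) (Fin m) ℝ) :
    MemGinv1 A X ↔
      ∀ j, IsL1MinSolution A (fun r => if r = j then 1 else 0) fun i => X i j := by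
  simp only [MemGinv1, isGenInverse_iff_mulVec_col hA]
  constructor
  · rintro ⟨hX, hmin⟩ j
    refine ⟨hX j, fun z hz => ?_⟩
    have h := hmin (X.updateCol j z) fun k => by
      rcases eq_or_ne k j with rfl | hk
      · simpa using hz
      · simpa [hk] using hX k
    rw [Finset.sum_comm, Finset.sum_comm (f := fun i k => |X.updateCol j z i k|),
      ← Finset.add_sum_erase _ _ (Finset.mem_univ j),
      ← Finset.add_sum_erase Finset.univ (fun k => ∑ i, |X.updateCol j z i k|)
        (Finset.mem_univ j)] at h
    have hrest : ∑ k ∈ Finset.univ.erase j, ∑ i, |X.updateCol j z i k|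
        = ∑ k ∈ Finset.univ.erase j, ∑ i, |X i k| :=
      Finset.sum_congr rfl fun k hk => by simp [Finset.ne_of_mem_erase hk]
    have h := le_of_add_le_add_right (hrest ▸ h)
    simpa using h
  · intro h
    refine ⟨fun j => (h j).1, fun Y hY => ?_⟩
    rw [Finset.sum_comm, Finset.sum_comm (f := fun i k => |Y i k|)]
    exact Finset.sum_le_sum fun j _ => (h j).2 _ (hY j)

/-- If `A ∈ ℝ^{m×n}` (`m < n`) has columns in general position and is in
general position with respect to each canonical basis vector of `ℝ^m`, then the set of
`ℓ^1`-norm-minimizing generalized inverses of `A` contains exactly one matrix, and every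
column of this matrix has exactly `m` non-zero entries. -/
theorem spinv_unique_and_m_sparse {m n : ℕ} (hmn : m < n)
    (A : Matrix (Fin m) (Fin n) ℝ)
    (hcols : ColsInGeneralPosition A)
    (hgen : ∀ i : Fin m, InGeneralPositionWrt A (fun r => if r = i then 1 else 0)) :
    ∃ X : Matrix (Fin n) (Fin m) ℝ,
      MemGinv1 A X ∧
      (∀ Y : Matrix (Fin n) (Fin m) ℝ, MemGinv1 A Y → Y = X) ∧
      ∀ j : Fin m, (Finset.univ.filter fun i => X i j ≠ 0).card = m := by
  have hsurj := hcols.mulVec_surjective hmn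
  choose x hx using fun j : Fin m => exists_isL1MinSolution (hsurj fun r => if r = j then 1 else 0)
  refine ⟨fun i j => x j i, (memGinv1_iff_isL1MinSolution_col hsurj _).mpr hx, fun Y hY => ?_,
    fun j => le_antisymm ((hx j).card_support_le hcols) ((hgen j).le_card_support (hx j).1)⟩
  ext i j
  exact congrFun ((hx j).eq hcols (hgen j)
    ((memGinv1_iff_isL1MinSolution_col hsurj Y).mp hY j)) i
end
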